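/- As x → ∞, one has ∑_{n ≤ x} τ(n) τ(n+1) = (6/π² + o(1)) · x (log x)², i.e., the limit of (∑_{1 ≤ n ≤ x} τ(n) τ(n+1)) / (x (log x)²) as x → ∞ exists and equals 6/π². -/

import Mathlib

open Filter

open Finset in
/-- The sum of `1 / (a b)` over coprime pairs `1 ≤ a, b ≤ D`. -/
noncomputable def coprimeHarmonicSum (D : ℕ) : ℝ :=
  ∑ p ∈ (Icc 1 D ×ˢ Icc 1 D) with p.1.Coprime p.2, 1 / ((p.1 : ℝ) * p.2)

open Finset in
theorem coprimeHarmonicSum_nonneg (D : ℕ) : 0 ≤ coprimeHarmonicSum D :=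
  sum_nonneg fun _ _ => by positivity

/-- A pair of positive integers determines its gcd and its reduced pair. -/
theorem scaled_coprime_pair_injective {g h a b c d : ℕ} (hg : 0 < g) (hab : a.Coprime b)
    (hcd : c.Coprime d) (h₁ : g * a = h * c) (h₂ : g * b = h * d) :
    g = h ∧ a = c ∧ b = d := by
  have e : g = h := by
    have e₁ : Nat.gcd (g * a) (g * b) = g := by rw [Nat.gcd_mul_left, hab, mul_one]
    have e₂ : Nat.gcd (h * c) (h * d) = h := by rw [Nat.gcd_mul_left, hcd, mul_one]
    rw [← e₁, h₁, h₂, e₂]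
  subst e
  exact ⟨rfl, Nat.eq_of_mul_eq_mul_left hg h₁, Nat.eq_of_mul_eq_mul_left hg h₂⟩

open Finset in
theorem sum_image_scaled_coprime (G D : ℕ) :
    ∑ q ∈ (Icc 1 G ×ˢ ((Icc 1 D ×ˢ Icc 1 D).filter fun p => p.1.Coprime p.2)).image
        (fun t : ℕ × ℕ × ℕ => (t.1 * t.2.1, t.1 * t.2.2)), 1 / ((q.1 : ℝ) * q.2) =
      (∑ g ∈ Icc 1 G, 1 / (g : ℝ) ^ 2) * coprimeHarmonicSum D := by
  rw [sum_image, coprimeHarmonicSum, sum_mul_sum, sum_product]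
  · refine sum_congr rfl fun g _ => sum_congr rfl fun p _ => ?_
    push_cast
    rw [div_mul_div_comm]
    congr 1 <;> ring
  · rintro ⟨g, a, b⟩ h₁ ⟨h, c, d⟩ h₂ e
    simp only [coe_product, Set.mem_prod, mem_coe, mem_Icc, mem_filter, mem_product] at h₁ h₂
    simp only [Prod.mk.injEq] at e ⊢
    exact scaled_coprime_pair_injective (by omega) h₁.2.2 h₂.2.2 e.1 e.2

open Finset in
theorem sum_one_div_mul_box (D : ℕ) :
    ∑ q ∈ Icc 1 D ×ˢ Icc 1 D, 1 / ((q.1 : ℝ) * q.2) = (harmonic D : ℝ) ^ 2 := by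
  rw [harmonic_eq_sum_Icc, sum_product, sq]
  push_cast
  rw [sum_mul_sum]
  refine sum_congr rfl fun a _ => sum_congr rfl fun b _ => ?_
  rw [one_div, mul_inv]

open Finset in
theorem sum_Icc_inv_sq_mul_coprimeHarmonicSum_le (G D : ℕ) :
    (∑ g ∈ Icc 1 G, 1 / (g : ℝ) ^ 2) * coprimeHarmonicSum D ≤ (harmonic (G * D) : ℝ) ^ 2 := by
  rw [← sum_image_scaled_coprime, ← sum_one_div_mul_box]
  refine sum_le_sum_of_subset_of_nonneg ?_ fun _ _ _ => by positivity
  intro q hq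
  simp only [mem_image, mem_product, mem_filter, mem_Icc] at hq ⊢
  obtain ⟨t, ⟨⟨h1, h2⟩, ⟨⟨h3, h4⟩, h5, h6⟩, -⟩, rfl⟩ := hq
  exact ⟨⟨Nat.mul_pos h1 h3, Nat.mul_le_mul h2 h4⟩, Nat.mul_pos h1 h5, Nat.mul_le_mul h2 h6⟩

open Finset in
theorem sum_Icc_inv_sq_le (G : ℕ) : ∑ g ∈ Icc 1 G, 1 / (g : ℝ) ^ 2 ≤ Real.pi ^ 2 / 6 :=
  sum_le_hasSum _ (fun _ _ => by positivity) hasSum_zeta_two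

open Finset in
theorem harmonic_sq_le_mul_coprimeHarmonicSum (D : ℕ) :
    (harmonic D : ℝ) ^ 2 ≤ Real.pi ^ 2 / 6 * coprimeHarmonicSum D := by
  refine le_trans ?_ (mul_le_mul_of_nonneg_right (sum_Icc_inv_sq_le D)
    (coprimeHarmonicSum_nonneg D))
  rw [← sum_image_scaled_coprime, ← sum_one_div_mul_box]
  refine sum_le_sum_of_subset_of_nonneg ?_ fun _ _ _ => by positivity
  rintro ⟨m, n⟩ hq
  simp only [mem_product, mem_Icc, mem_image, mem_filter] at hq ⊢
  obtain ⟨⟨hm, hm'⟩, hn, hn'⟩ := hq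
  have hg : 0 < Nat.gcd m n := Nat.gcd_pos_of_pos_left _ hm
  have h1 := Nat.div_pos (Nat.gcd_le_left n hm) hg
  have h2 := Nat.div_pos (Nat.gcd_le_right m hn) hg
  refine ⟨(Nat.gcd m n, m / Nat.gcd m n, n / Nat.gcd m n),
    ⟨⟨hg, (Nat.gcd_le_left n hm).trans hm'⟩, ⟨⟨h1, (Nat.div_le_self _ _).trans hm'⟩, h2,
      (Nat.div_le_self _ _).trans hn'⟩, Nat.coprime_div_gcd_div_gcd hg⟩, ?_⟩
  rw [Nat.mul_div_cancel' (Nat.gcd_dvd_left m n), Nat.mul_div_cancel' (Nat.gcd_dvd_right m n)]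

open Finset in
theorem card_divisors_le_two_mul {n D : ℕ} (h : n < (D + 1) ^ 2) :
    n.divisors.card ≤ 2 * ((Icc 1 D).filter (· ∣ n)).card := by
  have hsub : n.divisors ⊆
      (Icc 1 D).filter (· ∣ n) ∪ ((Icc 1 D).filter (· ∣ n)).image (n / ·) := by
    intro d hd
    obtain ⟨⟨e, rfl⟩, hn⟩ := Nat.mem_divisors.1 hd
    obtain ⟨hd0, he0⟩ := mul_ne_zero_iff.1 hn
    simp only [mem_union, mem_filter, mem_Icc, mem_image]
    by_cases hdD : d ≤ D
    · exact Or.inl ⟨⟨by omega, hdD⟩, dvd_mul_right _ _⟩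
    · refine Or.inr ⟨e, ⟨⟨by omega, ?_⟩, dvd_mul_left _ _⟩,
        Nat.mul_div_cancel _ (Nat.pos_of_ne_zero he0)⟩
      by_contra hc
      nlinarith
  calc n.divisors.card ≤ _ := card_le_card hsub
    _ ≤ _ := card_union_le _ _
    _ ≤ _ := by have := card_image_le (s := (Icc 1 D).filter (· ∣ n)) (f := (n / ·)); omega

open Finset in
theorem two_mul_card_le_card_divisors {n T : ℕ} (h : T ^ 2 < n) :
    2 * ((Icc 1 T).filter (· ∣ n)).card ≤ n.divisors.card := by
  set s := (Icc 1 T).filter (· ∣ n) with hs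
  have hmem : ∀ d ∈ s, d ≠ 0 ∧ d ≤ T ∧ d ∣ n := fun d hd => by
    simp only [hs, mem_filter, mem_Icc] at hd
    exact ⟨by omega, hd.1.2, hd.2⟩
  have hinj : Set.InjOn (n / ·) (s : Set ℕ) := by
    intro d hd e he hde
    obtain ⟨-, -, h1⟩ := hmem d hd
    obtain ⟨-, -, h2⟩ := hmem e he
    have hde' : n / d = n / e := hde
    rw [← Nat.div_div_self h1 (by omega), hde', Nat.div_div_self h2 (by omega)]
  have hdisj : Disjoint s (s.image (n / ·)) := by
    rw [disjoint_left]
    intro d hd hd'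
    obtain ⟨e, he, hed⟩ := mem_image.1 hd'
    obtain ⟨-, h1, -⟩ := hmem d hd
    obtain ⟨-, h2, h3⟩ := hmem e he
    have h4 : e * d = n := by rw [← hed]; exact Nat.mul_div_cancel' h3
    nlinarith [Nat.mul_le_mul h2 h1]
  have hsub : s ∪ s.image (n / ·) ⊆ n.divisors := by
    intro d hd
    rw [Nat.mem_divisors]
    refine ⟨?_, by omega⟩
    rcases mem_union.1 hd with hd | hd
    · exact (hmem d hd).2.2
    · obtain ⟨e, he, rfl⟩ := mem_image.1 hd
      exact Nat.div_dvd_of_dvd (hmem e he).2.2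
  have := card_le_card hsub
  rw [card_union_of_disjoint hdisj, card_image_of_injOn hinj] at this
  omega

open Finset in
/-- For coprime `d` and `a`, the integers `n ∈ (A, B]` with `d ∣ n` and `a ∣ n + 1` form one
residue class modulo `d a`. -/
theorem abs_card_consecutive_multiples_sub_le {d a A B : ℕ} (hd : 0 < d) (ha : 0 < a)
    (hda : d.Coprime a) (hAB : A ≤ B) :
    |(((Ioc A B).filter fun n => d ∣ n ∧ a ∣ n + 1).card : ℝ) - ((B : ℝ) - A) / (d * a)| ≤ 1 := by
  obtain ⟨k, hk1, hk2⟩ := Nat.chineseRemainder hda 0 (a - 1)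
  have hiff : ∀ n, (d ∣ n ∧ a ∣ n + 1) ↔ n ≡ k [MOD d * a] := by
    intro n
    rw [← Nat.modEq_and_modEq_iff_modEq_mul hda]
    refine and_congr ?_ ?_
    · rw [← Nat.modEq_zero_iff_dvd]
      exact ⟨fun h => h.trans hk1.symm, fun h => h.trans hk1⟩
    · rw [← Nat.modEq_zero_iff_dvd]
      have h0 : k + 1 ≡ 0 [MOD a] := by
        have := hk2.add_right 1
        rw [Nat.sub_add_cancel ha] at this
        exact this.trans (by simp [Nat.ModEq])
      exact ⟨fun h => Nat.ModEq.add_right_cancel' 1 (h.trans h0.symm),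
        fun h => (h.add_right 1).trans h0⟩
  simp_rw [hiff]
  have hr : 0 < d * a := Nat.mul_pos hd ha
  have hcard := Nat.Ioc_filter_modEq_card A B hr k
  have hrQ : (0 : ℚ) < ((d * a : ℕ) : ℚ) := by exact_mod_cast hr
  have hmono : ⌊((A : ℚ) - k) / ((d * a : ℕ) : ℚ)⌋ ≤ ⌊((B : ℚ) - k) / ((d * a : ℕ) : ℚ)⌋ := by
    have : (A : ℚ) ≤ B := by exact_mod_cast hAB
    gcongr
  rw [max_eq_left (by linarith)] at hcard
  have h1 := Int.floor_le (((A : ℚ) - k) / ((d * a : ℕ) : ℚ))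
  have h2 := Int.lt_floor_add_one (((A : ℚ) - k) / ((d * a : ℕ) : ℚ))
  have h3 := Int.floor_le (((B : ℚ) - k) / ((d * a : ℕ) : ℚ))
  have h4 := Int.lt_floor_add_one (((B : ℚ) - k) / ((d * a : ℕ) : ℚ))
  have hcardQ := congrArg (fun z : ℤ => (z : ℚ)) hcard
  simp only [Int.cast_natCast, Int.cast_sub] at hcardQ
  have hsplit : ((B : ℚ) - A) / ((d * a : ℕ) : ℚ) =
      ((B : ℚ) - k) / ((d * a : ℕ) : ℚ) - ((A : ℚ) - k) / ((d * a : ℕ) : ℚ) := by ring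
  have hQ : |(((Ioc A B).filter fun n => n ≡ k [MOD d * a]).card : ℚ) -
      ((B : ℚ) - A) / ((d * a : ℕ) : ℚ)| ≤ 1 := by
    rw [hcardQ, hsplit, abs_le]
    constructor <;> linarith
  have := (Rat.cast_le (K := ℝ)).2 hQ
  push_cast at this
  exact this

open Finset in
theorem sum_card_mul_card_eq (A B D : ℕ) :
    ∑ n ∈ Ioc A B, ((Icc 1 D).filter (· ∣ n)).card * ((Icc 1 D).filter (· ∣ n + 1)).card =
      ∑ p ∈ (Icc 1 D ×ˢ Icc 1 D) with p.1.Coprime p.2,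
        ((Ioc A B).filter fun n => p.1 ∣ n ∧ p.2 ∣ n + 1).card := by
  have h1 : ∀ n, ((Icc 1 D).filter (· ∣ n)).card * ((Icc 1 D).filter (· ∣ n + 1)).card =
      (((Icc 1 D ×ˢ Icc 1 D).filter fun p => p.1.Coprime p.2).filter
        fun p => p.1 ∣ n ∧ p.2 ∣ n + 1).card := by
    intro n
    rw [← card_product]
    congr 1
    ext ⟨d, a⟩
    simp only [mem_product, mem_filter]
    constructor
    · rintro ⟨⟨h1, h2⟩, h3, h4⟩
      exact ⟨⟨⟨h1, h3⟩, Nat.Coprime.of_dvd h2 h4 (by simp)⟩, h2, h4⟩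
    · rintro ⟨⟨⟨h1, h3⟩, -⟩, h2, h4⟩
      exact ⟨⟨h1, h2⟩, h3, h4⟩
  simp_rw [h1, card_filter _ (filter _ _), card_filter _ (Ioc A B)]
  exact sum_comm

open Finset in
theorem abs_sum_card_mul_card_sub_le {A B : ℕ} (D : ℕ) (hAB : A ≤ B) :
    |((∑ n ∈ Ioc A B, ((Icc 1 D).filter (· ∣ n)).card *
        ((Icc 1 D).filter (· ∣ n + 1)).card : ℕ) : ℝ) -
      ((B : ℝ) - A) * coprimeHarmonicSum D| ≤ (D : ℝ) ^ 2 := by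
  rw [sum_card_mul_card_eq, coprimeHarmonicSum, mul_sum]
  push_cast
  rw [← sum_sub_distrib]
  refine (abs_sum_le_sum_abs _ _).trans ?_
  calc _ ≤ ∑ p ∈ (Icc 1 D ×ˢ Icc 1 D) with p.1.Coprime p.2, (1 : ℝ) := by
        refine sum_le_sum fun p hp => ?_
        simp only [mem_filter, mem_product, mem_Icc] at hp
        rw [mul_one_div]
        exact abs_card_consecutive_multiples_sub_le hp.1.1.1 hp.1.2.1 hp.2 hAB
    _ ≤ ∑ p ∈ Icc 1 D ×ˢ Icc 1 D, (1 : ℝ) :=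
        sum_le_sum_of_subset_of_nonneg (filter_subset _ _) fun _ _ _ => zero_le_one
    _ = (D : ℝ) ^ 2 := by simp [sq]

open Finset in
theorem sum_divisors_mul_le {N D : ℕ} (h : N + 1 < (D + 1) ^ 2) :
    ∑ n ∈ Icc 1 N, ((n.divisors.card * (n + 1).divisors.card : ℕ) : ℝ) ≤
      4 * (N * coprimeHarmonicSum D + (D : ℝ) ^ 2) := by
  have h1 : ∑ n ∈ Icc 1 N, n.divisors.card * (n + 1).divisors.card ≤
      4 * ∑ n ∈ Ioc 0 N, ((Icc 1 D).filter (· ∣ n)).card *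
        ((Icc 1 D).filter (· ∣ n + 1)).card := by
    rw [mul_sum]
    refine sum_le_sum fun n hn => ?_
    have hn' := (mem_Icc.1 hn).2
    calc _ ≤ _ := Nat.mul_le_mul (card_divisors_le_two_mul (n := n) (D := D) (by omega))
            (card_divisors_le_two_mul (n := n + 1) (D := D) (by omega))
      _ = _ := by ring
  have h2 := (abs_le.1 (abs_sum_card_mul_card_sub_le D (Nat.zero_le N))).2
  have h3 := (Nat.cast_le (α := ℝ)).2 h1
  rw [Nat.cast_mul] at h3
  rw [← Nat.cast_sum]
  simp only [Nat.cast_zero, sub_zero, Nat.cast_ofNat] at h2 h3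
  linarith

open Finset in
theorem le_sum_divisors_mul {N T : ℕ} (h : T ^ 2 ≤ N) :
    4 * (((N : ℝ) - (T : ℝ) ^ 2) * coprimeHarmonicSum T - (T : ℝ) ^ 2) ≤
      ∑ n ∈ Icc 1 N, ((n.divisors.card * (n + 1).divisors.card : ℕ) : ℝ) := by
  have h1 : 4 * ∑ n ∈ Ioc (T ^ 2) N, ((Icc 1 T).filter (· ∣ n)).card *
        ((Icc 1 T).filter (· ∣ n + 1)).card ≤
      ∑ n ∈ Icc 1 N, n.divisors.card * (n + 1).divisors.card := by
    rw [mul_sum]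
    have hsub : Ioc (T ^ 2) N ⊆ Icc 1 N := fun n hn => by
      rw [mem_Ioc] at hn
      rw [mem_Icc]
      omega
    refine (sum_le_sum fun n hn => ?_).trans (sum_le_sum_of_subset hsub)
    have hn' := (mem_Ioc.1 hn).1
    calc _ = _ := by ring
      _ ≤ _ := Nat.mul_le_mul (two_mul_card_le_card_divisors (n := n) (T := T) hn')
            (two_mul_card_le_card_divisors (n := n + 1) (T := T) (by omega))
  have h2 := (abs_le.1 (abs_sum_card_mul_card_sub_le T h)).1
  have h3 := (Nat.cast_le (α := ℝ)).2 h1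
  rw [Nat.cast_mul] at h3
  rw [← Nat.cast_sum]
  simp only [Nat.cast_pow, Nat.cast_ofNat] at h2 h3
  linarith

open Finset in
theorem sum_divisors_div_le {G : ℕ} (hG : 0 < G) {x : ℝ} (hx : 1 < x) :
    (∑ n ∈ Icc 1 ⌊x⌋₊, ((n.divisors.card * (n + 1).divisors.card : ℕ) : ℝ)) /
        (x * Real.log x ^ 2) ≤
      (1 + 2 * (1 + Real.log G + Real.log 2 / 2) * (Real.log x)⁻¹) ^ 2 /
        (∑ g ∈ Icc 1 G, 1 / (g : ℝ) ^ 2) + 8 * (Real.log x)⁻¹ ^ 2 := by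
  have hx0 : 0 < x := by linarith
  have hL : 0 < Real.log x := Real.log_pos hx
  set Z := ∑ g ∈ Icc 1 G, 1 / (g : ℝ) ^ 2 with hZ
  have hZ0 : 0 < Z := sum_pos (fun g hg => by
    have : 0 < g := (mem_Icc.1 hg).1
    positivity) ⟨1, mem_Icc.2 ⟨le_rfl, hG⟩⟩
  set N := ⌊x⌋₊
  set D := Nat.sqrt (N + 1)
  have hN : (N : ℝ) ≤ x := Nat.floor_le hx0.le
  have hDN : D ^ 2 ≤ N + 1 := Nat.sqrt_le' _
  have hD : (D : ℝ) ^ 2 ≤ 2 * x := by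
    have : (D : ℝ) ^ 2 ≤ N + 1 := by exact_mod_cast hDN
    linarith
  have hD0 : 0 < D := Nat.sqrt_pos.2 (Nat.succ_pos _)
  have hS := sum_divisors_mul_le (Nat.lt_succ_sqrt' (N + 1))
  have hlogD : Real.log D ≤ Real.log 2 / 2 + Real.log x / 2 := by
    have h1 : Real.log ((D : ℝ) ^ 2) ≤ Real.log (2 * x) := Real.log_le_log (by positivity) hD
    rw [Real.log_pow, Real.log_mul two_ne_zero hx0.ne'] at h1
    push_cast at h1
    linarith
  have hH : (harmonic (G * D) : ℝ) ≤ 1 + Real.log G + Real.log 2 / 2 + Real.log x / 2 := by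
    have := harmonic_le_one_add_log (G * D)
    rw [Nat.cast_mul, Real.log_mul (by positivity) (by positivity)] at this
    linarith
  have hH0 : (0 : ℝ) ≤ harmonic (G * D) := by
    exact_mod_cast (harmonic_pos (Nat.mul_pos hG hD0).ne').le
  have hC : coprimeHarmonicSum D ≤
      (1 + Real.log G + Real.log 2 / 2 + Real.log x / 2) ^ 2 / Z := by
    rw [le_div_iff₀' hZ0]
    exact (sum_Icc_inv_sq_mul_coprimeHarmonicSum_le G D).trans (by gcongr)
  rw [div_le_iff₀ (by positivity)]
  refine hS.trans ?_
  calc 4 * (N * coprimeHarmonicSum D + (D : ℝ) ^ 2)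
      ≤ 4 * (x * ((1 + Real.log G + Real.log 2 / 2 + Real.log x / 2) ^ 2 / Z) + 2 * x) := by
        have := coprimeHarmonicSum_nonneg D
        gcongr
    _ = _ := by
        field_simp
        ring

open Finset in
theorem le_sum_divisors_div {G : ℕ} (hG : 1 < G) {x : ℝ} (hx : 4 * (G : ℝ) ^ 2 < x) :
    4 * (1 - 1 / (G : ℝ) ^ 2 - x⁻¹) * (6 / Real.pi ^ 2) *
        (1 / 2 - Real.log G * (Real.log x)⁻¹) ^ 2 - 4 * (Real.log x)⁻¹ ^ 2 ≤
      (∑ n ∈ Icc 1 ⌊x⌋₊, ((n.divisors.card * (n + 1).divisors.card : ℕ) : ℝ)) /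
        (x * Real.log x ^ 2) := by
  have hG1 : (2 : ℝ) ≤ G := by exact_mod_cast hG
  have hx1 : 16 < x := by nlinarith
  have hx0 : 0 < x := by linarith
  have hL : 0 < Real.log x := Real.log_pos (by linarith)
  set N := ⌊x⌋₊
  set y := √x / G
  have hy0 : 0 < y := by positivity
  have hy2 : y ^ 2 = x / (G : ℝ) ^ 2 := by rw [div_pow, Real.sq_sqrt hx0.le]
  have hy1 : 1 ≤ y := by
    rw [← one_le_sq_iff₀ hy0.le, hy2, le_div_iff₀ (by positivity)]
    nlinarith
  set T := ⌊y⌋₊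
  have hT : (T : ℝ) ≤ y := Nat.floor_le hy0.le
  have hT2 : (T : ℝ) ^ 2 ≤ x / (G : ℝ) ^ 2 := by rw [← hy2]; gcongr
  have hT2x : x / (G : ℝ) ^ 2 ≤ x / 4 :=
    div_le_div_of_nonneg_left hx0.le (by norm_num) (by nlinarith)
  have hTN : T ^ 2 ≤ N := Nat.le_floor (by push_cast; linarith)
  have hN : x - 1 ≤ N := by linarith [Nat.lt_floor_add_one x]
  have hlogy : Real.log y = Real.log x / 2 - Real.log G := by
    rw [Real.log_div (by positivity) (by positivity), Real.log_sqrt hx0.le]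
  have hC : 6 / Real.pi ^ 2 * (Real.log x / 2 - Real.log G) ^ 2 ≤ coprimeHarmonicSum T := by
    have h1 : Real.log y ^ 2 ≤ (harmonic T : ℝ) ^ 2 :=
      pow_le_pow_left₀ (Real.log_nonneg hy1) (log_le_harmonic_floor y hy0.le) 2
    have h2 := h1.trans (harmonic_sq_le_mul_coprimeHarmonicSum T)
    rw [hlogy] at h2
    have hpi : 0 < Real.pi := Real.pi_pos
    calc _ ≤ 6 / Real.pi ^ 2 * (Real.pi ^ 2 / 6 * coprimeHarmonicSum T) := by gcongr
      _ = _ := by field_simp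
  rw [le_div_iff₀ (by positivity)]
  refine le_trans ?_ (le_sum_divisors_mul hTN)
  calc _ = 4 * ((x - 1 - x / (G : ℝ) ^ 2) *
          (6 / Real.pi ^ 2 * (Real.log x / 2 - Real.log G) ^ 2) - x) := by
        field_simp
        ring
    _ ≤ 4 * (((N : ℝ) - (T : ℝ) ^ 2) * coprimeHarmonicSum T - (T : ℝ) ^ 2) := by
        have h3 : 0 ≤ x - 1 - x / (G : ℝ) ^ 2 := by linarith
        have h4 : x - 1 - x / (G : ℝ) ^ 2 ≤ (N : ℝ) - (T : ℝ) ^ 2 := by linarith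
        have h5 : (T : ℝ) ^ 2 ≤ x := by linarith
        have := mul_le_mul h4 hC (by positivity) (h3.trans h4)
        linarith

/-- The additive divisor problem: `∑_{n ≤ x} τ(n) τ(n+1) ∼ (6/π²) x (log x)²`. -/
theorem shifted_divisor_asymptotic :
    Tendsto
      (fun x : ℝ =>
        (∑ n ∈ Finset.Icc 1 ⌊x⌋₊, ((n.divisors.card * (n + 1).divisors.card : ℕ) : ℝ)) /
          (x * Real.log x ^ 2))
      atTop (nhds (6 / Real.pi ^ 2)) := by
  have hpi : Real.pi ≠ 0 := Real.pi_ne_zero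
  have hlog : Tendsto (fun x : ℝ => (Real.log x)⁻¹) atTop (nhds 0) :=
    tendsto_inv_atTop_zero.comp Real.tendsto_log_atTop
  rw [tendsto_order]
  constructor
  · intro b hb
    have hG : Tendsto (fun G : ℕ => 4 * (1 - 1 / (G : ℝ) ^ 2 - 0) * (6 / Real.pi ^ 2) *
        (1 / 2) ^ 2) atTop (nhds (6 / Real.pi ^ 2)) := by
      have h : Tendsto (fun G : ℕ => 1 / (G : ℝ) ^ 2) atTop (nhds 0) := by
        simpa using (tendsto_inv_atTop_nhds_zero_nat (𝕜 := ℝ)).pow 2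
      have h' := ((((h.const_sub 1).sub_const 0).const_mul 4).mul_const
        (6 / Real.pi ^ 2)).mul_const ((1 / 2 : ℝ) ^ 2)
      convert h' using 2
      ring
    obtain ⟨G, hGb, hG1⟩ := ((hG.eventually (lt_mem_nhds hb)).and (eventually_gt_atTop 1)).exists
    have hlim : Tendsto (fun x : ℝ => 4 * (1 - 1 / (G : ℝ) ^ 2 - x⁻¹) * (6 / Real.pi ^ 2) *
        (1 / 2 - Real.log G * (Real.log x)⁻¹) ^ 2 - 4 * (Real.log x)⁻¹ ^ 2) atTop
        (nhds (4 * (1 - 1 / (G : ℝ) ^ 2 - 0) * (6 / Real.pi ^ 2) * (1 / 2) ^ 2)) := by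
      have h := ((((tendsto_inv_atTop_zero (𝕜 := ℝ)).const_sub (1 - 1 / (G : ℝ) ^ 2)).const_mul
        4).mul_const (6 / Real.pi ^ 2)).mul
        (((hlog.const_mul (Real.log G)).const_sub (1 / 2)).pow 2)
      simpa using h.sub ((hlog.pow 2).const_mul 4)
    filter_upwards [hlim.eventually (lt_mem_nhds hGb), eventually_gt_atTop (4 * (G : ℝ) ^ 2)]
      with x h1 h2
    exact h1.trans_le (le_sum_divisors_div hG1 h2)
  · intro b hb
    have hG : Tendsto (fun G : ℕ => 1 / ∑ g ∈ Finset.Icc 1 G, 1 / (g : ℝ) ^ 2) atTop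
        (nhds (6 / Real.pi ^ 2)) := by
      have h := (tendsto_add_atTop_iff_nat 1).2 hasSum_zeta_two.tendsto_sum_nat
      have h' := h.inv₀ (by positivity)
      rw [inv_div] at h'
      refine h'.congr fun G => ?_
      rw [one_div, Finset.range_eq_Ico, Finset.sum_eq_sum_Ico_succ_bot (Nat.succ_pos G)]
      simp [Finset.Ico_add_one_right_eq_Icc]
    obtain ⟨G, hGb, hG1⟩ := ((hG.eventually (gt_mem_nhds hb)).and (eventually_gt_atTop 0)).exists
    have hlim : Tendsto (fun x : ℝ =>
        (1 + 2 * (1 + Real.log G + Real.log 2 / 2) * (Real.log x)⁻¹) ^ 2 /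
          (∑ g ∈ Finset.Icc 1 G, 1 / (g : ℝ) ^ 2) + 8 * (Real.log x)⁻¹ ^ 2) atTop
        (nhds (1 / ∑ g ∈ Finset.Icc 1 G, 1 / (g : ℝ) ^ 2)) := by
      have h := (((hlog.const_mul (2 * (1 + Real.log G + Real.log 2 / 2))).const_add 1).pow
        2).div_const (∑ g ∈ Finset.Icc 1 G, 1 / (g : ℝ) ^ 2)
      simpa using h.add ((hlog.pow 2).const_mul 8)
    filter_upwards [hlim.eventually (gt_mem_nhds hGb), eventually_gt_atTop 1] with x h1 h2
    exact (sum_divisors_div_le hG1 h2).trans_lt h1
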